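/- Let x₀ > 0 and let φ be a nonnegative differentiable function on [x₀,∞) such that y(x) = x + φ(x) is strictly increasing, with inverse x(y) defined on [y₀,∞) where y₀ = y(x₀), and set ψ(y) = y − x(y). Assume there exist constants C > 0 and y* ≥ y₀ such that for all y ≥ y*: (a) ψ′(y) ∈ [0,1], (b) ψ(y) ≤ C·log y, and (c) y·ψ′(y) ≤ C. Let Y be a random variable taking values in [0,∞) with distribution function G having finite moments ν_n = E[Y^n] of all positive integer orders, such that G is absolutely continuous on [x₀,∞) with density g(x) = G′(x) > 0 there. If lim_{x→∞} φ(x)/x = 0 and limsup_{x→∞} g((x+φ(x))²) / g(x²) < 1, then ∑_{n=1}^∞ ν_n^{−1/(2n)} = ∞ and G is uniquely determined by its moments among all probability distributions on [0,∞). -/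

import Mathlib

open MeasureTheory Filter Set

/-- Moment-determinacy on `ℝ₊` among all probability distributions on `[0,∞)`. -/
def IsMomentDetOnNonneg (μ : Measure ℝ) : Prop :=
  ∀ ν : Measure ℝ, IsProbabilityMeasure ν → ν (Set.Iio 0) = 0 →
    (∀ n : ℕ, 0 < n → Integrable (fun x => x ^ n) ν ∧
      ∫ x, x ^ n ∂ν = ∫ x, x ^ n ∂μ) → ν = μ

section Bang

variable {E : Type*} [NormedAddCommGroup E] [NormedSpace ℝ E] {F : ℕ → ℝ → E} {M : ℕ → ℝ}

/-- Forward propagation of weighted bounds on the first `m + 1` derivatives of a function. -/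
lemma norm_le_mul_exp_of_norm_le (hF : ∀ n t, HasDerivAt (F n) (F (n + 1) t) t)
    (hM : ∀ n, 0 < M n) (hbd : ∀ n t, ‖F n t‖ ≤ M n)
    (hlc : Monotone fun n => M (n + 1) / M n) (m : ℕ) {x : ℝ}
    (hx : ∀ j, ‖F j x‖ ≤ Real.exp (j - (m + 1)) * M j) :
    ∀ i ≤ m + 1, ∀ y, x ≤ y → ‖F (m + 1 - i) y‖ ≤
      Real.exp ((m + 1 - i : ℕ) - (m + 1)) * M (m + 1 - i) *
        Real.exp (Real.exp 1 * (M (m + 1) / M m) * (y - x)) := by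
  set r := M (m + 1) / M m with hr
  have hr0 : 0 < r := div_pos (hM _) (hM _)
  have he : 0 < Real.exp 1 := Real.exp_pos 1
  intro i
  induction i with
  | zero =>
    intro _ y hy
    have h1 : 1 ≤ Real.exp (Real.exp 1 * r * (y - x)) :=
      Real.one_le_exp (by have := sub_nonneg.2 hy; positivity)
    have h2 := hbd (m + 1) y
    have h3 := hM (m + 1)
    simp only [Nat.sub_zero, Nat.cast_add, Nat.cast_one, sub_self, Real.exp_zero, one_mul]
    nlinarith
  | succ i ih =>
    intro hi y hy
    obtain ⟨j, hj⟩ : ∃ j, m + 1 - (i + 1) = j := ⟨_, rfl⟩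
    have hj1 : m + 1 - i = j + 1 := by omega
    rw [hj]
    rw [hj1] at ih
    have hjm : j ≤ m := by omega
    set c := Real.exp ((j : ℝ) - (m + 1)) * M j with hc
    have hc0 : 0 < c := mul_pos (Real.exp_pos _) (hM j)
    have hstep : Real.exp (((j + 1 : ℕ) : ℝ) - (m + 1)) * M (j + 1) ≤ c * (Real.exp 1 * r) := by
      have h1 : M (j + 1) ≤ r * M j := by
        rw [← div_le_iff₀ (hM j)]
        exact hlc hjm
      have h2 : Real.exp (((j + 1 : ℕ) : ℝ) - (m + 1)) =
          Real.exp ((j : ℝ) - (m + 1)) * Real.exp 1 := by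
        rw [← Real.exp_add]; push_cast; ring_nf
      rw [h2, hc]
      have := Real.exp_pos ((j : ℝ) - (m + 1))
      calc _ ≤ Real.exp ((j : ℝ) - (m + 1)) * Real.exp 1 * (r * M j) := by gcongr
        _ = _ := by ring
    refine image_norm_le_of_norm_deriv_right_le_deriv_boundary (f := F j) (f' := F (j + 1))
      (a := x) (b := y) (B := fun z => c * Real.exp (Real.exp 1 * r * (z - x)))
      (B' := fun z => c * (Real.exp (Real.exp 1 * r * (z - x)) * (Real.exp 1 * r)))
      (fun z _ => (hF j z).continuousAt.continuousWithinAt)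
      (fun z _ => (hF j z).hasDerivWithinAt) ?_ ?_ ?_ ⟨hy, le_rfl⟩
    · simpa using hx j
    · intro z
      refine HasDerivAt.const_mul c (HasDerivAt.exp ?_)
      simpa using ((hasDerivAt_id z).sub_const x).const_mul (Real.exp 1 * r)
    · intro z hz
      refine (ih (by omega) z hz.1).trans ?_
      calc _ ≤ c * (Real.exp 1 * r) * Real.exp (Real.exp 1 * r * (z - x)) := by gcongr
        _ = _ := by ring

/-- **Bang's estimate** for functions all of whose derivatives vanish at the origin. -/
lemma norm_le_exp_sub_mul_of_flat (hF : ∀ n t, HasDerivAt (F n) (F (n + 1) t) t)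
    (hM : ∀ n, 0 < M n) (hbd : ∀ n t, ‖F n t‖ ≤ M n)
    (hlc : Monotone fun n => M (n + 1) / M n) (h0 : ∀ n, F n 0 = 0) (k : ℕ) :
    ∀ m : ℕ, ∀ t, 0 ≤ t →
      Real.exp 1 * t ≤ ∑ i ∈ Finset.range k, M (m + i) / M (m + i + 1) →
      ∀ j, ‖F j t‖ ≤ Real.exp (j - m) * M j := by
  induction k with
  | zero =>
    intro m t ht hle j
    have he : 0 < Real.exp 1 := Real.exp_pos 1
    have : t = 0 := by
      simp only [Finset.range_zero, Finset.sum_empty] at hle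
      nlinarith
    subst this
    rw [h0, norm_zero]
    have := hM j
    positivity
  | succ k ih =>
    intro m t ht hle j
    rcases le_or_gt m j with hmj | hmj
    · have h1 : 1 ≤ Real.exp ((j : ℝ) - m) :=
        Real.one_le_exp (sub_nonneg.2 (by exact_mod_cast hmj))
      have := hbd j t
      have := hM j
      nlinarith
    have he : 0 < Real.exp 1 := Real.exp_pos 1
    rw [Finset.sum_range_succ'] at hle
    set s := ∑ i ∈ Finset.range k, M (m + 1 + i) / M (m + 1 + i + 1) with hs
    have hs' : ∑ i ∈ Finset.range k, M (m + (i + 1)) / M (m + (i + 1) + 1) = s :=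
      Finset.sum_congr rfl fun i _ => by rw [show m + (i + 1) = m + 1 + i by ring]
    rw [hs'] at hle
    have hs0 : 0 ≤ s := Finset.sum_nonneg fun i _ => (div_pos (hM _) (hM _)).le
    set x := min t (s / Real.exp 1) with hxdef
    have hx0 : 0 ≤ x := le_min ht (by positivity)
    have hxs : Real.exp 1 * x ≤ s := by
      have := min_le_right t (s / Real.exp 1)
      rw [le_div_iff₀ he] at this
      linarith
    have hx := ih (m + 1) x hx0 hxs
    push_cast at hx
    have key := norm_le_mul_exp_of_norm_le hF hM hbd hlc m hx (m + 1 - j) (by omega) t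
      (min_le_left _ _)
    rw [show m + 1 - (m + 1 - j) = j by omega] at key
    refine key.trans ?_
    have hexp : Real.exp 1 * (M (m + 1) / M m) * (t - x) ≤ 1 := by
      have h1 : Real.exp 1 * (t - x) ≤ M m / M (m + 1) := by
        rcases le_total t (s / Real.exp 1) with h | h
        · rw [hxdef, min_eq_left h, sub_self, mul_zero]
          exact (div_pos (hM _) (hM _)).le
        · rw [hxdef, min_eq_right h, mul_sub, mul_div_cancel₀ _ he.ne']
          simp only [add_zero] at hle
          linarith
      have hp : 0 < M (m + 1) / M m := div_pos (hM _) (hM _)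
      calc _ = (M (m + 1) / M m) * (Real.exp 1 * (t - x)) := by ring
        _ ≤ (M (m + 1) / M m) * (M m / M (m + 1)) := by gcongr
        _ = 1 := by
          have := (hM m).ne'
          have := (hM (m + 1)).ne'
          field_simp
    calc _ ≤ Real.exp ((j : ℝ) - (m + 1)) * M j * Real.exp 1 := by
          have := hM j
          gcongr
      _ = Real.exp ((j : ℝ) - m) * M j := by
          rw [mul_right_comm, ← Real.exp_add]; ring_nf

/-- **Denjoy–Carleman theorem**, in a form where the successive derivatives are given. -/
lemma eq_zero_of_flat_of_tendsto_sum_div (hF : ∀ n t, HasDerivAt (F n) (F (n + 1) t) t)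
    (hM : ∀ n, 0 < M n) (hbd : ∀ n t, ‖F n t‖ ≤ M n)
    (hlc : Monotone fun n => M (n + 1) / M n) (h0 : ∀ n, F n 0 = 0)
    (hdiv : Tendsto (fun N => ∑ i ∈ Finset.range N, M i / M (i + 1)) atTop atTop)
    {t : ℝ} (ht : 0 ≤ t) : F 0 t = 0 := by
  have hle : ∀ m : ℕ, ‖F 0 t‖ ≤ Real.exp (-m) * M 0 := by
    intro m
    obtain ⟨k, hk⟩ := ((tendsto_atTop.1 hdiv
      (Real.exp 1 * t + ∑ i ∈ Finset.range m, M i / M (i + 1))).and (eventually_ge_atTop m)).exists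
    obtain ⟨l, rfl⟩ := Nat.exists_eq_add_of_le hk.2
    have h := hk.1
    rw [Finset.sum_range_add] at h
    simpa using norm_le_exp_sub_mul_of_flat hF hM hbd hlc h0 l m t ht (by linarith) 0
  have hlim : Tendsto (fun m : ℕ => Real.exp (-m) * M 0) atTop (nhds 0) := by
    simpa using (Real.tendsto_exp_neg_atTop_nhds_zero.comp
      tendsto_natCast_atTop_atTop).mul_const (M 0)
  exact norm_le_zero_iff.1 (ge_of_tendsto' hlim hle)

end Bang

/-- The partial-sum form of **Carleman's inequality** for the ratios `M i / M (i + 1)`. -/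
lemma sum_rpow_neg_inv_le (M : ℕ → ℝ) (hM : ∀ n, 0 < M n) (h0 : M 0 = 1) (N : ℕ) :
    ∑ n ∈ Finset.range N, M (n + 1) ^ (-((n + 1 : ℕ) : ℝ)⁻¹) ≤
      2 * Real.exp 1 * ∑ i ∈ Finset.range N, M i / M (i + 1) := by
  set a : ℕ → ℝ := fun i => M i / M (i + 1) with ha
  have ha0 : ∀ i, 0 < a i := fun i => div_pos (hM _) (hM _)
  have hprod : ∀ n, ∏ i ∈ Finset.range n, a i = (M n)⁻¹ := by
    intro n
    induction n with
    | zero => simp [h0]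
    | succ n ih =>
      rw [Finset.prod_range_succ, ih, ha]
      have := (hM n).ne'
      field_simp
  have hterm : ∀ n : ℕ, M (n + 1) ^ (-((n + 1 : ℕ) : ℝ)⁻¹) ≤
      ∑ i ∈ Finset.range (n + 1), Real.exp 1 * ((i + 1) * a i) / (n + 1) ^ 2 := by
    intro n
    have hn : (0 : ℝ) < ((n + 1 : ℕ) : ℝ) := by positivity
    have h1 := Real.geom_mean_le_arith_mean (Finset.range (n + 1)) (fun _ => 1)
      (fun i => ((i : ℝ) + 1) * a i) (by simp) (by simp; positivity)
      (fun i _ => mul_nonneg (by positivity) (ha0 i).le)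
    simp only [Real.rpow_one, one_mul, Finset.sum_const, Finset.card_range, nsmul_eq_mul,
      mul_one, Finset.prod_mul_distrib, hprod] at h1
    have hfac : ∏ i ∈ Finset.range (n + 1), ((i : ℝ) + 1) = ((n + 1).factorial : ℝ) := by
      rw [← Finset.prod_range_add_one_eq_factorial]; push_cast; rfl
    have hMpos : 0 < (M (n + 1))⁻¹ := inv_pos.2 (hM _)
    have hfp : (0 : ℝ) < (n + 1).factorial := by positivity
    rw [hfac, Real.mul_rpow hfp.le hMpos.le] at h1
    have hroot : ((n + 1 : ℕ) : ℝ) / Real.exp 1 ≤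
        ((n + 1).factorial : ℝ) ^ (((n + 1 : ℕ) : ℝ)⁻¹) := by
      have h2 := Real.pow_div_factorial_le_exp ((n + 1 : ℕ) : ℝ) hn.le (n + 1)
      rw [div_le_iff₀ hfp] at h2
      have h3 : (((n + 1 : ℕ) : ℝ) / Real.exp 1) ^ (n + 1) ≤ ((n + 1).factorial : ℝ) := by
        rw [div_pow, div_le_iff₀ (by positivity), ← Real.exp_nat_mul, mul_one, mul_comm]
        exact h2
      calc ((n + 1 : ℕ) : ℝ) / Real.exp 1
          = ((((n + 1 : ℕ) : ℝ) / Real.exp 1) ^ (n + 1)) ^ (((n + 1 : ℕ) : ℝ)⁻¹) := by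
            rw [Real.pow_rpow_inv_natCast (by positivity) (by omega)]
        _ ≤ _ := by gcongr
    rw [Real.inv_rpow (hM _).le, ← Real.rpow_neg (hM _).le] at h1
    have hX : 0 ≤ M (n + 1) ^ (-((n + 1 : ℕ) : ℝ)⁻¹) := Real.rpow_nonneg (hM _).le _
    have h4 := (mul_le_mul_of_nonneg_right hroot hX).trans h1
    rw [← Finset.sum_div, ← Finset.mul_sum]
    rw [le_div_iff₀ (by positivity)]
    rw [le_div_iff₀ hn] at h4
    push_cast at h4 ⊢
    have he := Real.exp_pos 1
    calc _ = Real.exp 1 * ((n + 1) / Real.exp 1 * M (n + 1) ^ (-((n : ℝ) + 1)⁻¹) * (n + 1)) := by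
          field_simp
      _ ≤ _ := by gcongr
  have htel : ∀ i N : ℕ, i ≤ N →
      ∑ n ∈ Finset.Ico i N, (1 : ℝ) / ((n : ℝ) + 1) ^ 2 ≤
        2 / ((i : ℝ) + 1) - 2 / ((N : ℝ) + 1) := by
    intro i N hiN
    induction N, hiN using Nat.le_induction with
    | base => simp
    | succ N hN ih =>
      rw [Finset.sum_Ico_succ_top hN]
      have h1 : (1 : ℝ) / ((N : ℝ) + 1) ^ 2 ≤ 2 / ((N : ℝ) + 1) - 2 / ((N : ℝ) + 1 + 1) := by
        rw [← sub_nonneg]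
        have : (2 : ℝ) / ((N : ℝ) + 1) - 2 / ((N : ℝ) + 1 + 1) - 1 / ((N : ℝ) + 1) ^ 2 =
            N / (((N : ℝ) + 1) ^ 2 * ((N : ℝ) + 1 + 1)) := by
          field_simp; ring
        rw [this]
        positivity
      push_cast
      linarith
  calc ∑ n ∈ Finset.range N, M (n + 1) ^ (-((n + 1 : ℕ) : ℝ)⁻¹)
      ≤ ∑ n ∈ Finset.range N, ∑ i ∈ Finset.range (n + 1),
          Real.exp 1 * ((i + 1) * a i) / (n + 1) ^ 2 := Finset.sum_le_sum fun n _ => hterm n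
    _ = ∑ i ∈ Finset.range N, ∑ n ∈ Finset.Ico i N,
          Real.exp 1 * ((i + 1) * a i) / (n + 1) ^ 2 := by
        refine Finset.sum_comm' fun n i => ?_
        simp only [Finset.mem_range, Finset.mem_Ico]
        omega
    _ ≤ ∑ i ∈ Finset.range N, 2 * Real.exp 1 * a i := by
        refine Finset.sum_le_sum fun i hi => ?_
        have h1 := htel i N (Finset.mem_range.1 hi).le
        have h2 : (0 : ℝ) ≤ 2 / ((N : ℝ) + 1) := by positivity
        have h3 := ha0 i
        calc _ = Real.exp 1 * ((i + 1) * a i) *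
                ∑ n ∈ Finset.Ico i N, (1 : ℝ) / ((n : ℝ) + 1) ^ 2 := by
              rw [Finset.mul_sum]
              exact Finset.sum_congr rfl fun n _ => by ring
          _ ≤ Real.exp 1 * ((i + 1) * a i) * (2 / ((i : ℝ) + 1)) := by
              gcongr
              linarith
          _ = 2 * Real.exp 1 * a i := by field_simp
    _ = _ := by rw [Finset.mul_sum]

/-- Carleman's condition on the even terms of a log-convex sequence forces the sequence to be
positive and its successive ratios to have a divergent sum. -/
lemma pos_and_tendsto_sum_div_of_carleman {M : ℕ → ℝ} (hM : ∀ n, 0 ≤ M n) (h0 : M 0 = 1)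
    (hlc : ∀ n, M (n + 1) ^ 2 ≤ M n * M (n + 2))
    (hcar : Tendsto (fun N : ℕ => ∑ n ∈ Finset.Icc 1 N, M (2 * n) ^ (-(1 : ℝ) / (2 * n)))
      atTop atTop) :
    (∀ n, 0 < M n) ∧
      Tendsto (fun N => ∑ i ∈ Finset.range N, M i / M (i + 1)) atTop atTop := by
  have hpos : ∀ n, 0 < M n := by
    intro k
    refine (hM k).lt_of_ne' fun hk => ?_
    have hzero : ∀ n, k ≤ n → M n = 0 := by
      intro n hn
      induction n, hn using Nat.le_induction with
      | base => exact hk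
      | succ n _ ih =>
        have := hlc n
        rw [ih, zero_mul] at this
        exact pow_eq_zero_iff two_ne_zero |>.1 (le_antisymm this (sq_nonneg _))
    refine not_tendsto_const_atTop _ _ (hcar.congr' (f₂ := fun _ : ℕ =>
      ∑ n ∈ Finset.Icc 1 k, M (2 * n) ^ (-(1 : ℝ) / (2 * n))) ?_)
    filter_upwards [eventually_ge_atTop k] with N hN
    refine (Finset.sum_subset (Finset.Icc_subset_Icc_right hN) fun n hn hn' => ?_).symm
    simp only [Finset.mem_Icc, not_and, not_le] at hn hn'
    have hn0 : (n : ℝ) ≠ 0 := by have := hn.1; positivity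
    rw [hzero _ (by have := hn' hn.1; omega), Real.zero_rpow (by simp [hn0])]
  refine ⟨hpos, ?_⟩
  have hbound : ∀ N : ℕ, ∑ n ∈ Finset.Icc 1 N, M (2 * n) ^ (-(1 : ℝ) / (2 * n)) ≤
      2 * Real.exp 1 * ∑ i ∈ Finset.range (2 * N), M i / M (i + 1) := by
    intro N
    refine le_trans ?_ (sum_rpow_neg_inv_le M hpos h0 (2 * N))
    have himg : ∑ n ∈ Finset.Icc 1 N, M (2 * n) ^ (-(1 : ℝ) / (2 * n)) =
        ∑ i ∈ (Finset.Icc 1 N).image (fun n => 2 * n - 1),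
          M (i + 1) ^ (-((i + 1 : ℕ) : ℝ)⁻¹) := by
      rw [Finset.sum_image]
      · refine Finset.sum_congr rfl fun n hn => ?_
        have h1 : 2 * n - 1 + 1 = 2 * n := by have := (Finset.mem_Icc.1 hn).1; omega
        rw [h1]; push_cast; rw [neg_div, one_div]
      · intro a ha b hb hab
        have := (Finset.mem_Icc.1 ha).1
        have := (Finset.mem_Icc.1 hb).1
        simp only at hab
        omega
    rw [himg]
    refine Finset.sum_le_sum_of_subset_of_nonneg ?_ fun i _ _ => Real.rpow_nonneg (hM _) _
    intro i hi
    simp only [Finset.mem_image, Finset.mem_Icc, Finset.mem_range] at hi ⊢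
    omega
  have he : 0 < 2 * Real.exp 1 := by positivity
  have hmono : Monotone fun N => ∑ i ∈ Finset.range N, M i / M (i + 1) :=
    monotone_nat_of_le_succ fun N => by
      rw [Finset.sum_range_succ]
      have := div_pos (hpos N) (hpos (N + 1))
      linarith
  refine tendsto_atTop_atTop_of_monotone hmono fun b => ?_
  obtain ⟨N, hN⟩ := (tendsto_atTop.1 hcar (2 * Real.exp 1 * b)).exists
  exact ⟨2 * N, le_of_mul_le_mul_left (hN.trans (hbound N)) he⟩

/-- **Carleman's criterion** for the Hamburger moment problem. -/
theorem ext_of_moments_of_carleman {P Q : Measure ℝ} [IsProbabilityMeasure P]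
    [IsProbabilityMeasure Q] (hP : ∀ n : ℕ, Integrable (fun x => x ^ n) P)
    (hQ : ∀ n : ℕ, Integrable (fun x => x ^ n) Q)
    (hPQ : ∀ n : ℕ, ∫ x, x ^ n ∂P = ∫ x, x ^ n ∂Q)
    (hcar : Tendsto (fun N : ℕ => ∑ n ∈ Finset.Icc 1 N,
      (∫ x, x ^ (2 * n) ∂P) ^ (-(1 : ℝ) / (2 * n))) atTop atTop) : P = Q := by
  have habs : ∀ {L : Measure ℝ}, (∀ n : ℕ, Integrable (fun x => x ^ n) L) →
      ∀ n : ℕ, Integrable (fun x => |x| ^ n) L := fun hR n => by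
    simpa using (hR n).abs
  have hmem : ∀ {L : Measure ℝ} [IsProbabilityMeasure L],
      (∀ n : ℕ, Integrable (fun x => x ^ n) L) → ∀ n : ℕ, MemLp id n L := by
    intro L _ hR n
    rcases Nat.eq_zero_or_pos n with rfl | hn
    · simpa using aestronglyMeasurable_id
    · rw [← integrable_norm_rpow_iff aestronglyMeasurable_id (by simp; omega) (by simp)]
      simpa using habs hR n
  have hsmooth : ∀ {L : Measure ℝ} [IsProbabilityMeasure L],
      (∀ n : ℕ, Integrable (fun x => x ^ n) L) → ∀ n t,
      HasDerivAt (iteratedDeriv n (charFun L)) (iteratedDeriv (n + 1) (charFun L) t) t := by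
    intro L _ hR n t
    rw [iteratedDeriv_succ]
    have h : ContDiff ℝ (n + 1 : ℕ) (charFun L) := contDiff_charFun (hmem hR (n + 1))
    exact (h.differentiable_iteratedDeriv n (by exact_mod_cast n.lt_succ_self) t).hasDerivAt
  have hnorm : ∀ {L : Measure ℝ} [IsProbabilityMeasure L],
      (∀ n : ℕ, Integrable (fun x => x ^ n) L) → ∀ n t,
      ‖iteratedDeriv n (charFun L) t‖ ≤ ∫ x, |x| ^ n ∂L := by
    intro L _ hR n t
    rw [iteratedDeriv_charFun (hmem hR n), norm_mul, norm_pow, Complex.norm_I, one_pow, one_mul]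
    refine (norm_integral_le_integral_norm _).trans_eq (integral_congr_ae (ae_of_all _ fun x => ?_))
    have : ‖Complex.exp (t * x * Complex.I)‖ = 1 := by
      exact_mod_cast Complex.norm_exp_ofReal_mul_I (t * x)
    simp [this]
  set M : ℕ → ℝ := fun n => (∫ x, |x| ^ n ∂P + ∫ x, |x| ^ n ∂Q) / 2 with hMdef
  have hquad : ∀ {L : Measure ℝ}, (∀ n : ℕ, Integrable (fun x => x ^ n) L) → ∀ n (s : ℝ),
      0 ≤ (∫ x, |x| ^ (n + 2) ∂L) * (s * s) + 2 * (∫ x, |x| ^ (n + 1) ∂L) * s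
        + ∫ x, |x| ^ n ∂L := by
    intro L hR n s
    have h : ∫ x, |x| ^ n * (|x| * s + 1) ^ 2 ∂L = (∫ x, |x| ^ (n + 2) ∂L) * (s * s)
        + 2 * (∫ x, |x| ^ (n + 1) ∂L) * s + ∫ x, |x| ^ n ∂L := by
      have i0 := habs hR n
      have i1 := (habs hR (n + 1)).const_mul (2 * s)
      have i2 := (habs hR (n + 2)).const_mul (s * s)
      have e : ∀ x : ℝ, |x| ^ n * (|x| * s + 1) ^ 2 =
          (s * s) * |x| ^ (n + 2) + (2 * s) * |x| ^ (n + 1) + |x| ^ n := fun x => by ring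
      have i3 : Integrable
          (fun x => (s * s) * |x| ^ (n + 2) + (2 * s) * |x| ^ (n + 1)) L := i2.add i1
      simp_rw [e]
      rw [integral_add i3 i0, integral_add i2 i1, integral_const_mul, integral_const_mul]
      ring
    rw [← h]
    exact integral_nonneg fun x => by positivity
  have hM0 : ∀ n, 0 ≤ M n := fun n => by
    have h1 : 0 ≤ ∫ x, |x| ^ n ∂P := integral_nonneg fun x => by positivity
    have h2 : 0 ≤ ∫ x, |x| ^ n ∂Q := integral_nonneg fun x => by positivity
    simp only [hMdef]
    positivity
  have hM1 : M 0 = 1 := by simp [hMdef]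
  have hlc : ∀ n, M (n + 1) ^ 2 ≤ M n * M (n + 2) := by
    intro n
    have h : discrim (M (n + 2)) (2 * M (n + 1)) (M n) ≤ 0 := discrim_le_zero fun s => by
      have h1 := hquad hP n s
      have h2 := hquad hQ n s
      simp only [hMdef]
      linarith
    rw [discrim] at h
    linarith
  have heven : ∀ n, M (2 * n) = ∫ x, x ^ (2 * n) ∂P := by
    intro n
    have h : ∀ x : ℝ, |x| ^ (2 * n) = x ^ (2 * n) := fun x => (even_two_mul n).pow_abs x
    simp only [hMdef, h, ← hPQ]
    ring
  simp_rw [← heven] at hcar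
  obtain ⟨hpos, hdiv⟩ := pos_and_tendsto_sum_div_of_carleman hM0 hM1 hlc hcar
  have hratio : Monotone fun n => M (n + 1) / M n := monotone_nat_of_le_succ fun n => by
    rw [div_le_div_iff₀ (hpos _) (hpos _)]
    nlinarith [hlc n]
  set F : ℕ → ℝ → ℂ := fun n t =>
    (1 / 2 : ℂ) * (iteratedDeriv n (charFun P) t - iteratedDeriv n (charFun Q) t) with hFdef
  have hflat : ∀ t, 0 ≤ t → charFun P t = charFun Q t := by
    intro t ht
    have h := eq_zero_of_flat_of_tendsto_sum_div (F := F)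
      (fun n t => ((hsmooth hP n t).sub (hsmooth hQ n t)).const_mul _) hpos
      (fun n t => ?_) hratio (fun n => ?_) hdiv ht
    · simpa [hFdef, sub_eq_zero] using h
    · have h1 := hnorm hP n t
      have h2 := hnorm hQ n t
      have h3 := norm_sub_le (iteratedDeriv n (charFun P) t) (iteratedDeriv n (charFun Q) t)
      simp only [hFdef, hMdef, norm_mul]
      norm_num
      linarith
    · simp [hFdef, iteratedDeriv_charFun_zero (hmem hP n), iteratedDeriv_charFun_zero (hmem hQ n),
        hPQ]
  refine Measure.ext_of_charFun (funext fun t => ?_)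
  rcases le_total 0 t with ht | ht
  · exact hflat t ht
  · have h := hflat (-t) (by linarith)
    rw [charFun_neg, charFun_neg] at h
    exact star_injective h

/-- The law of `ε √X`, where `X` has law `μ` and `ε` is an independent random sign. -/
noncomputable def symmSqrt (μ : Measure ℝ) : Measure ℝ :=
  (2⁻¹ : ENNReal) • (μ.map (fun x => √x) + μ.map (fun x => -√x))

section symmSqrt

variable {μ : Measure ℝ}

instance [IsProbabilityMeasure μ] : IsProbabilityMeasure (symmSqrt μ) := by
  constructor
  have h1 : IsProbabilityMeasure (μ.map (fun x => √x)) :=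
    Measure.isProbabilityMeasure_map (by fun_prop)
  have h2 : IsProbabilityMeasure (μ.map (fun x => -√x)) :=
    Measure.isProbabilityMeasure_map (by fun_prop)
  simp only [symmSqrt, Measure.smul_apply, Measure.add_apply, measure_univ, smul_eq_mul]
  rw [one_add_one_eq_two, ENNReal.inv_mul_cancel (by simp) (by simp)]

lemma map_sq_symmSqrt (hμ : μ (Iio 0) = 0) : (symmSqrt μ).map (fun x => x ^ 2) = μ := by
  have hae : ∀ᵐ x ∂μ, 0 ≤ x := by
    rw [ae_iff]
    simpa [Iio] using hμ
  have h1 : μ.map ((fun x => x ^ 2) ∘ fun x => √x) = μ := by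
    conv_rhs => rw [← Measure.map_id (μ := μ)]
    refine Measure.map_congr ?_
    filter_upwards [hae] with x hx
    simp [Real.sq_sqrt hx]
  have h2 : μ.map ((fun x => x ^ 2) ∘ fun x => -√x) = μ := by
    conv_rhs => rw [← Measure.map_id (μ := μ)]
    refine Measure.map_congr ?_
    filter_upwards [hae] with x hx
    simp [Real.sq_sqrt hx]
  rw [symmSqrt, Measure.map_smul, Measure.map_add _ _ (by fun_prop),
    Measure.map_map (by fun_prop) (by fun_prop), Measure.map_map (by fun_prop) (by fun_prop),
    h1, h2, ← two_smul ENNReal, smul_smul, ENNReal.inv_mul_cancel (by simp) (by simp), one_smul]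

lemma integrable_sqrt_pow [IsFiniteMeasure μ] (h : ∀ n : ℕ, Integrable (fun x => x ^ n) μ)
    (n : ℕ) : Integrable (fun x => √x ^ n) μ := by
  refine ((integrable_const (1 : ℝ)).add (h n).abs).mono' (by fun_prop) (ae_of_all _ fun x => ?_)
  rw [Real.norm_of_nonneg (by positivity)]
  simp only [Pi.add_apply, abs_pow]
  rcases le_total x 1 with hx | hx
  · have h1 : √x ^ n ≤ 1 := pow_le_one₀ (Real.sqrt_nonneg x) (Real.sqrt_le_one.2 hx)
    have : 0 ≤ |x| ^ n := by positivity
    linarith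
  · have h1 : √x ≤ |x| := by
      rw [abs_of_nonneg (by linarith), Real.sqrt_le_left (by linarith)]
      nlinarith
    have : √x ^ n ≤ |x| ^ n := by gcongr
    linarith

lemma integrable_pow_symmSqrt [IsFiniteMeasure μ] (h : ∀ n : ℕ, Integrable (fun x => x ^ n) μ)
    (n : ℕ) : Integrable (fun x => x ^ n) (symmSqrt μ) := by
  refine Integrable.smul_measure (integrable_add_measure.2 ⟨?_, ?_⟩) (by simp)
  · rw [integrable_map_measure (by fun_prop) (by fun_prop)]
    exact integrable_sqrt_pow h n
  · rw [integrable_map_measure (by fun_prop) (by fun_prop)]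
    refine ((integrable_sqrt_pow h n).const_mul ((-1) ^ n)).congr (ae_of_all _ fun x => ?_)
    simp [neg_pow (√x)]

lemma integral_pow_symmSqrt [IsFiniteMeasure μ] (h : ∀ n : ℕ, Integrable (fun x => x ^ n) μ)
    (n : ℕ) : ∫ x, x ^ n ∂symmSqrt μ = (1 + (-1) ^ n) / 2 * ∫ x, √x ^ n ∂μ := by
  have h1 : Integrable (fun x => x ^ n) (μ.map (fun x => √x)) := by
    rw [integrable_map_measure (by fun_prop) (by fun_prop)]
    exact integrable_sqrt_pow h n
  have h2 : Integrable (fun x => x ^ n) (μ.map (fun x => -√x)) := by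
    rw [integrable_map_measure (by fun_prop) (by fun_prop)]
    refine ((integrable_sqrt_pow h n).const_mul ((-1) ^ n)).congr (ae_of_all _ fun x => ?_)
    simp [neg_pow (√x)]
  rw [symmSqrt, integral_smul_measure, integral_add_measure h1 h2,
    integral_map (by fun_prop) (by fun_prop), integral_map (by fun_prop) (by fun_prop)]
  simp_rw [neg_pow (√_)]
  rw [integral_const_mul]
  simp
  ring

lemma integral_pow_two_mul_symmSqrt [IsFiniteMeasure μ] (hμ : μ (Iio 0) = 0)
    (h : ∀ n : ℕ, Integrable (fun x => x ^ n) μ) (n : ℕ) :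
    ∫ x, x ^ (2 * n) ∂symmSqrt μ = ∫ x, x ^ n ∂μ := by
  have hae : ∀ᵐ x ∂μ, 0 ≤ x := by
    rw [ae_iff]
    simpa [Iio] using hμ
  rw [integral_pow_symmSqrt h, (even_two_mul n).neg_one_pow, one_add_one_eq_two, div_self (by simp),
    one_mul]
  refine integral_congr_ae ?_
  filter_upwards [hae] with x hx
  rw [pow_mul, Real.sq_sqrt hx]

end symmSqrt

/-- **Carleman's criterion** for the Stieltjes moment problem. -/
theorem isMomentDetOnNonneg_of_carleman {μ : Measure ℝ} [IsProbabilityMeasure μ]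
    (hμ : μ (Iio 0) = 0) (hmom : ∀ n : ℕ, Integrable (fun x => x ^ n) μ)
    (hcar : Tendsto (fun N : ℕ => ∑ n ∈ Finset.Icc 1 N,
      (∫ x, x ^ n ∂μ) ^ (-(1 : ℝ) / (2 * n))) atTop atTop) : IsMomentDetOnNonneg μ := by
  intro ν _ hν hνμ
  have hν_int : ∀ n : ℕ, Integrable (fun x => x ^ n) ν := fun n => by
    rcases Nat.eq_zero_or_pos n with rfl | hn
    · simp
    · exact (hνμ n hn).1
  have heq : ∀ n : ℕ, ∫ x, x ^ n ∂ν = ∫ x, x ^ n ∂μ := fun n => by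
    rcases Nat.eq_zero_or_pos n with rfl | hn
    · simp
    · exact (hνμ n hn).2
  have h : symmSqrt μ = symmSqrt ν := by
    refine ext_of_moments_of_carleman (integrable_pow_symmSqrt hmom)
      (integrable_pow_symmSqrt hν_int) (fun n => ?_) ?_
    · obtain ⟨k, rfl | rfl⟩ := n.even_or_odd'
      · rw [integral_pow_two_mul_symmSqrt hμ hmom, integral_pow_two_mul_symmSqrt hν hν_int, heq]
      · rw [integral_pow_symmSqrt hmom, integral_pow_symmSqrt hν_int,
          (odd_two_mul_add_one k).neg_one_pow]
        simp
    · simpa only [integral_pow_two_mul_symmSqrt hμ hmom] using hcar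
  rw [← map_sq_symmSqrt hμ, ← map_sq_symmSqrt hν, h]

section TailContraction

variable {μ : Measure ℝ} {a : ℝ} {g : ℝ → ℝ}

lemma setLIntegral_pow_of_density (ha : 0 < a) (hg : Measurable g)
    (hac : μ.restrict (Ici a) =
      (volume.restrict (Ici a)).withDensity (fun x => ENNReal.ofReal (g x)))
    (n : ℕ) {A : Set ℝ} (hA : MeasurableSet A) (hsub : A ⊆ Ici a) :
    ∫⁻ t in A, ENNReal.ofReal (t ^ n) ∂μ = ∫⁻ t in A, ENNReal.ofReal (t ^ n * g t) := by
  have h1 : μ.restrict A = (volume.restrict A).withDensity (fun x => ENNReal.ofReal (g x)) := by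
    have h := congrArg (fun m : Measure ℝ => m.restrict A) hac
    rwa [Measure.restrict_restrict_of_subset hsub, restrict_withDensity hA,
      Measure.restrict_restrict_of_subset hsub] at h
  rw [h1, lintegral_withDensity_eq_lintegral_mul _ (by fun_prop) (by fun_prop)]
  refine setLIntegral_congr_fun hA fun t ht => ?_
  have ht0 : 0 ≤ t := ha.le.trans (hsub ht)
  simp only [Pi.mul_apply]
  rw [ENNReal.ofReal_mul (by positivity), mul_comm]

/-- If the tail of the density of `μ` contracts under a change of variables `S`, then the tail
moments of `μ` are controlled by the cut-off point. -/
lemma setLIntegral_pow_le_of_contraction [IsProbabilityMeasure μ] (ha : 0 < a) (hg : Measurable g)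
    (hac : μ.restrict (Ici a) =
      (volume.restrict (Ici a)).withDensity (fun x => ENNReal.ofReal (g x)))
    (n : ℕ) {S S' : ℝ → ℝ} {τ q : ℝ} (hτ : a ≤ τ) (hq : 0 ≤ q)
    (hS : ∀ t ∈ Ici τ, HasDerivAt S (S' t) t) (hinj : InjOn S (Ici τ))
    (hSτ : a ≤ S τ) (hSmono : ∀ t ∈ Ici τ, S τ ≤ S t)
    (hle : ∀ t ∈ Ici τ, t ^ n * g t ≤ q * (|S' t| * (S t ^ n * g (S t)))) :
    ∫⁻ t in Ici τ, ENNReal.ofReal (t ^ n) ∂μ ≤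
      ENNReal.ofReal q * (ENNReal.ofReal (τ ^ n) + ∫⁻ t in Ici τ, ENNReal.ofReal (t ^ n) ∂μ) := by
  have hτ0 : 0 ≤ τ := ha.le.trans hτ
  calc ∫⁻ t in Ici τ, ENNReal.ofReal (t ^ n) ∂μ
      = ∫⁻ t in Ici τ, ENNReal.ofReal (t ^ n * g t) :=
        setLIntegral_pow_of_density ha hg hac n measurableSet_Ici (Ici_subset_Ici.2 hτ)
    _ ≤ ∫⁻ t in Ici τ, ENNReal.ofReal q *
          (ENNReal.ofReal |S' t| * ENNReal.ofReal (S t ^ n * g (S t))) := by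
        refine setLIntegral_mono' measurableSet_Ici fun t ht => ?_
        rw [← ENNReal.ofReal_mul (abs_nonneg _), ← ENNReal.ofReal_mul hq]
        exact ENNReal.ofReal_le_ofReal (hle t ht)
    _ = ENNReal.ofReal q * ∫⁻ s in S '' Ici τ, ENNReal.ofReal (s ^ n * g s) := by
        rw [lintegral_const_mul' _ _ ENNReal.ofReal_ne_top,
          lintegral_image_eq_lintegral_abs_deriv_mul measurableSet_Ici
            (fun t ht => (hS t ht).hasDerivWithinAt) hinj]
    _ ≤ ENNReal.ofReal q * ∫⁻ s in Ici (S τ), ENNReal.ofReal (s ^ n * g s) := by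
        gcongr
        rintro _ ⟨t, ht, rfl⟩
        exact hSmono t ht
    _ = ENNReal.ofReal q * ∫⁻ s in Ici (S τ), ENNReal.ofReal (s ^ n) ∂μ := by
        rw [setLIntegral_pow_of_density ha hg hac n measurableSet_Ici (Ici_subset_Ici.2 hSτ)]
    _ ≤ ENNReal.ofReal q * ∫⁻ s in Ico (S τ) τ ∪ Ici τ, ENNReal.ofReal (s ^ n) ∂μ := by
        gcongr
        intro s hs
        rcases lt_or_ge s τ with h | h
        · exact Or.inl ⟨hs, h⟩
        · exact Or.inr h
    _ ≤ ENNReal.ofReal q * (∫⁻ s in Ico (S τ) τ, ENNReal.ofReal (s ^ n) ∂μ +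
          ∫⁻ t in Ici τ, ENNReal.ofReal (t ^ n) ∂μ) := by
        gcongr
        exact lintegral_union_le _ _ _
    _ ≤ _ := by
        gcongr
        calc ∫⁻ s in Ico (S τ) τ, ENNReal.ofReal (s ^ n) ∂μ
            ≤ ∫⁻ _ in Ico (S τ) τ, ENNReal.ofReal (τ ^ n) ∂μ := by
              refine setLIntegral_mono' measurableSet_Ico fun s hs => ?_
              have : 0 ≤ s := (ha.le.trans hSτ).trans hs.1
              have := hs.2.le
              gcongr
          _ ≤ ENNReal.ofReal (τ ^ n) * 1 := by
              rw [setLIntegral_const]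
              gcongr
              exact prob_le_one
          _ = _ := mul_one _

lemma integral_pow_le_of_contraction [IsProbabilityMeasure μ] (ha : 0 < a) (hg : Measurable g)
    (hac : μ.restrict (Ici a) =
      (volume.restrict (Ici a)).withDensity (fun x => ENNReal.ofReal (g x)))
    (hμ : μ (Iio 0) = 0) (n : ℕ) (hmom : Integrable (fun x => x ^ n) μ)
    {S S' : ℝ → ℝ} {τ q : ℝ} (hτ : a ≤ τ) (hq : 0 ≤ q) (hq1 : q < 1)
    (hS : ∀ t ∈ Ici τ, HasDerivAt S (S' t) t) (hinj : InjOn S (Ici τ))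
    (hSτ : a ≤ S τ) (hSmono : ∀ t ∈ Ici τ, S τ ≤ S t)
    (hle : ∀ t ∈ Ici τ, t ^ n * g t ≤ q * (|S' t| * (S t ^ n * g (S t)))) :
    ∫ x, x ^ n ∂μ ≤ (1 - q)⁻¹ * τ ^ n := by
  have hτ0 : 0 ≤ τ := ha.le.trans hτ
  have hae : ∀ᵐ x ∂μ, 0 ≤ x := by
    rw [ae_iff]
    simpa [Iio] using hμ
  set J := ∫⁻ t in Ici τ, ENNReal.ofReal (t ^ n) ∂μ with hJ
  have hJle := setLIntegral_pow_le_of_contraction ha hg hac n hτ hq hS hinj hSτ hSmono hle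
  rw [← hJ] at hJle
  have hJtop : J ≠ ⊤ := by
    refine ne_top_of_le_ne_top hmom.lintegral_lt_top.ne ?_
    exact setLIntegral_le_lintegral _ _
  have htotal : ∫⁻ t, ENNReal.ofReal (t ^ n) ∂μ ≤ ENNReal.ofReal (τ ^ n) + J := by
    rw [← lintegral_add_compl (fun t => ENNReal.ofReal (t ^ n)) (measurableSet_Ici (a := τ)),
      add_comm, compl_Ici]
    gcongr
    calc ∫⁻ s in Iio τ, ENNReal.ofReal (s ^ n) ∂μ
        ≤ ∫⁻ _ in Iio τ, ENNReal.ofReal (τ ^ n) ∂μ := by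
          refine lintegral_mono_ae ?_
          filter_upwards [ae_restrict_of_ae hae, ae_restrict_mem measurableSet_Iio] with s hs hs'
          have := (mem_Iio.1 hs').le
          gcongr
      _ ≤ ENNReal.ofReal (τ ^ n) * 1 := by
          rw [setLIntegral_const]
          gcongr
          exact prob_le_one
      _ = _ := mul_one _
  lift J to NNReal using hJtop with j
  rw [show (j : ENNReal) = ENNReal.ofReal j by simp,
    ← ENNReal.ofReal_add (by positivity) j.coe_nonneg] at htotal hJle
  rw [← ENNReal.ofReal_mul hq, ENNReal.ofReal_le_ofReal_iff (by positivity)] at hJle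
  rw [integral_eq_lintegral_of_nonneg_ae (by filter_upwards [hae] with x hx; positivity)
    (by fun_prop)]
  have h1 := ENNReal.toReal_mono ENNReal.ofReal_ne_top htotal
  rw [ENNReal.toReal_ofReal (by positivity)] at h1
  refine h1.trans ?_
  rw [inv_mul_eq_div, le_div_iff₀ (by linarith)]
  linarith

end TailContraction

lemma tendsto_sum_one_div_mul_log :
    Tendsto (fun N : ℕ => ∑ n ∈ Finset.Icc 1 N, (1 : ℝ) / (n * Real.log (n + 2))) atTop atTop := by
  have hbound : ∀ N : ℕ, Real.log (Real.log (N + 3)) - Real.log (Real.log 3) ≤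
      ∑ n ∈ Finset.Icc 1 N, (1 : ℝ) / (n * Real.log (n + 2)) := by
    intro N
    induction N with
    | zero => simp
    | succ N ih =>
      rw [Finset.sum_Icc_succ_top (by omega)]
      push_cast
      have hl : 0 < Real.log ((N : ℝ) + 3) :=
        Real.log_pos (by have := N.cast_nonneg (α := ℝ); linarith)
      have hl' : 0 < Real.log ((N : ℝ) + 4) :=
        Real.log_pos (by have := N.cast_nonneg (α := ℝ); linarith)
      have h1 : Real.log (Real.log ((N : ℝ) + 4)) - Real.log (Real.log ((N : ℝ) + 3)) ≤
          1 / (((N : ℝ) + 1) * Real.log ((N : ℝ) + 3)) := by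
        have h2 : Real.log ((N : ℝ) + 4) - Real.log ((N : ℝ) + 3) ≤ 1 / ((N : ℝ) + 1) := by
          rw [← Real.log_div (by positivity) (by positivity)]
          refine (Real.log_le_sub_one_of_pos (by positivity)).trans ?_
          have h3 : ((N : ℝ) + 4) / (N + 3) - 1 = 1 / (N + 3) := by field_simp; ring
          rw [h3]
          gcongr
          norm_num
        rw [← Real.log_div hl'.ne' hl.ne']
        refine (Real.log_le_sub_one_of_pos (by positivity)).trans ?_
        rw [div_sub_one hl.ne', ← div_div]
        gcongr
      rw [show (N : ℝ) + 1 + 3 = N + 4 by ring, show (N : ℝ) + 1 + 2 = N + 3 by ring]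
      linarith
  refine tendsto_atTop_mono hbound (tendsto_atTop_add_const_right _ _ ?_)
  exact Real.tendsto_log_atTop.comp (Real.tendsto_log_atTop.comp
    (tendsto_atTop_add_const_right _ _ tendsto_natCast_atTop_atTop))

/-- Moments growing at most like `(B n log n) ^ (2 n)` satisfy Carleman's condition. -/
lemma tendsto_sum_rpow_of_le {ν : ℕ → ℝ} (hν : ∀ n, 0 < n → 0 < ν n) {B : ℝ} (hB : 0 < B)
    (hle : ∀ n : ℕ, 0 < n → ν n ≤ (B * (n * Real.log (n + 2))) ^ (2 * n)) :
    Tendsto (fun N : ℕ => ∑ n ∈ Finset.Icc 1 N, ν n ^ (-(1 : ℝ) / (2 * n))) atTop atTop := by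
  refine tendsto_atTop_mono (fun N => ?_)
    (tendsto_sum_one_div_mul_log.const_mul_atTop (inv_pos.2 hB))
  rw [Finset.mul_sum]
  refine Finset.sum_le_sum fun n hn => ?_
  have hn : 0 < n := (Finset.mem_Icc.1 hn).1
  have hn' : (0 : ℝ) < n := by exact_mod_cast hn
  have hl : 0 < Real.log ((n : ℝ) + 2) := Real.log_pos (by linarith)
  set X := B * (n * Real.log (n + 2)) with hX
  have hX0 : 0 < X := by positivity
  have h1 : (X ^ (2 * n)) ^ (-(1 : ℝ) / (2 * n)) = X⁻¹ := by
    have := Real.pow_rpow_inv_natCast hX0.le (n := 2 * n) (by omega)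
    rw [neg_div, Real.rpow_neg (by positivity), one_div]
    push_cast at this
    rw [this]
  calc B⁻¹ * (1 / (n * Real.log (n + 2))) = X⁻¹ := by rw [hX, mul_inv, one_div]
    _ = (X ^ (2 * n)) ^ (-(1 : ℝ) / (2 * n)) := h1.symm
    _ ≤ _ := Real.rpow_le_rpow_of_nonpos (hν n hn) (hle n hn)
        (div_nonpos_of_nonpos_of_nonneg (by norm_num) (by positivity))

/-- Positivity of the moments of a law that has a positive density on a half-line. -/
lemma integral_pow_pos_of_density {μ : Measure ℝ} {a : ℝ} {g : ℝ → ℝ} (ha : 0 < a)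
    (hg : Measurable g)
    (hac : μ.restrict (Ici a) =
      (volume.restrict (Ici a)).withDensity (fun x => ENNReal.ofReal (g x)))
    (hpos : ∀ x ∈ Ici a, 0 < g x) (hμ : μ (Iio 0) = 0) (n : ℕ)
    (hmom : Integrable (fun x => x ^ n) μ) : 0 < ∫ x, x ^ n ∂μ := by
  have hae : ∀ᵐ x ∂μ, 0 ≤ x := by
    rw [ae_iff]
    simpa [Iio] using hμ
  have hnn : 0 ≤ᵐ[μ] fun x => x ^ n := by
    filter_upwards [hae] with x hx
    exact pow_nonneg hx n
  rw [integral_pos_iff_support_of_nonneg_ae hnn hmom]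
  have hsub : Ici a ⊆ Function.support fun x : ℝ => x ^ n := fun x hx =>
    (pow_pos (ha.trans_le hx) n).ne'
  refine lt_of_lt_of_le ?_ (measure_mono hsub)
  rw [← Measure.restrict_apply_univ, hac, withDensity_apply _ MeasurableSet.univ,
    Measure.restrict_univ, setLIntegral_pos_iff (by fun_prop)]
  have : (Function.support fun x => ENNReal.ofReal (g x)) ∩ Ici a = Ici a :=
    inter_eq_right.2 fun x hx => by simpa using hpos x hx
  rw [this]
  simp

/-- The cut-off points `K n log (n + 2)` dominate their own logarithm by a factor of order `n`. -/
lemma exists_const_forall_mul_log_le {D : ℝ} (hD : 0 ≤ D) (Y : ℝ) :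
    ∃ K : ℝ, 0 < K ∧ ∀ n : ℕ, 0 < n → Y ≤ K * (n * Real.log (n + 2)) ∧
      n * D * Real.log (K * (n * Real.log (n + 2))) ≤ K * (n * Real.log (n + 2)) := by
  have hlim : Tendsto (fun K : ℝ => D * (Real.log K + 2) / K) atTop (nhds 0) := by
    have h1 := Real.isLittleO_log_id_atTop.tendsto_div_nhds_zero
    have h2 : Tendsto (fun K : ℝ => 2 * K⁻¹) atTop (nhds 0) := by
      simpa using tendsto_inv_atTop_zero.const_mul (2 : ℝ)
    have h3 := (h1.add h2).const_mul D
    simp only [add_zero, mul_zero, id] at h3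
    exact h3.congr fun K => by ring
  obtain ⟨K, hK, hK1, hKY⟩ := ((hlim.eventually_le_const one_pos).and
    ((eventually_ge_atTop 1).and (eventually_ge_atTop Y))).exists
  have hK0 : 0 < K := by linarith
  rw [div_le_one hK0] at hK
  refine ⟨K, hK0, fun n hn => ?_⟩
  have hn1 : (1 : ℝ) ≤ n := by exact_mod_cast hn
  set l := Real.log ((n : ℝ) + 2) with hl
  have hl1 : 1 ≤ l := by
    rw [hl, Real.le_log_iff_exp_le (by linarith)]
    linarith [Real.exp_one_lt_d9]
  have hln : Real.log n ≤ l := Real.log_le_log (by linarith) (by linarith)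
  have hll : Real.log l ≤ l := (Real.log_le_sub_one_of_pos (by linarith)).trans (by linarith)
  have hnl : 1 ≤ n * l := by nlinarith
  have hlK : 0 ≤ Real.log K := Real.log_nonneg hK1
  refine ⟨by nlinarith, ?_⟩
  rw [Real.log_mul hK0.ne' (by positivity), Real.log_mul (by positivity) (by positivity)]
  have h1 : Real.log K + (Real.log n + Real.log l) ≤ (Real.log K + 2) * l := by nlinarith
  calc n * D * (Real.log K + (Real.log n + Real.log l)) ≤ n * D * ((Real.log K + 2) * l) := by
        gcongr
    _ = (D * (Real.log K + 2)) * (n * l) := by ring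
    _ ≤ K * (n * l) := by gcongr

/-- Bernoulli-type bound: subtracting a logarithmic term barely changes the `2 n`-th power beyond
a suitable threshold. -/
lemma mul_pow_le_pow_of_log_le {C q T : ℝ} (hC : 0 ≤ C) (hq : 0 ≤ q) (n : ℕ) (hn : 0 < n)
    (hT : Real.exp 1 ≤ T) (hlog : 2 * n * C * Real.log T ≤ (1 - q) * T) {x y : ℝ} (hy : T ≤ y)
    (hx : y - C * Real.log y ≤ x) : q * y ^ (2 * n) ≤ x ^ (2 * n) := by
  have he := Real.exp_pos 1
  have hT0 : 0 < T := by linarith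
  have hy0 : 0 < y := by linarith
  have hn1 : (1 : ℝ) ≤ n := by exact_mod_cast hn
  have hanti : Real.log y / y ≤ Real.log T / T :=
    Real.log_div_self_antitoneOn (a := T) (b := y) hT (hT.trans hy) hy
  have h1 : 2 * n * (C * (Real.log y / y)) ≤ 1 - q := by
    calc 2 * n * (C * (Real.log y / y)) ≤ 2 * n * (C * (Real.log T / T)) := by gcongr
      _ = 2 * n * C * Real.log T / T := by ring
      _ ≤ 1 - q := by rwa [div_le_iff₀ hT0]
  set u := C * (Real.log y / y) with hu
  have hu1 : u ≤ 1 / 2 := by nlinarith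
  have h2 := one_add_mul_le_pow (a := -u) (by linarith) (2 * n)
  have h3 : q ≤ (1 + -u) ^ (2 * n) := by
    refine le_trans ?_ h2
    push_cast
    linarith
  have h4 : (1 + -u) * y ≤ x := by
    refine le_trans (le_of_eq ?_) hx
    rw [hu]
    field_simp
    ring
  have h5 : 0 ≤ 1 + -u := by linarith
  calc q * y ^ (2 * n) ≤ (1 + -u) ^ (2 * n) * y ^ (2 * n) := by gcongr
    _ = ((1 + -u) * y) ^ (2 * n) := (mul_pow _ _ _).symm
    _ ≤ x ^ (2 * n) := by gcongr

/-- The limsup condition on the density, rewritten along the inverse of `x ↦ x + φ x`. -/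
lemma exists_ratio_of_limsup_lt_one {x₀ : ℝ} {φ xinv g : ℝ → ℝ}
    (hmono : StrictMonoOn (fun x => x + φ x) (Ici x₀))
    (hinv : ∀ y ∈ Ici (x₀ + φ x₀), xinv y ∈ Ici x₀ ∧ xinv y + φ (xinv y) = y)
    (hg_pos : ∀ x ∈ Ici x₀, 0 < g x)
    (hlimsup : limsup (fun x => ENNReal.ofReal (g ((x + φ x) ^ 2) / g (x ^ 2))) atTop < 1) :
    ∃ ρ : ℝ, 0 ≤ ρ ∧ ρ < 1 ∧ ∀ᶠ y in atTop,
      g (y ^ 2) ≤ ρ * g (xinv y ^ 2) ∧ x₀ ≤ xinv y ∧ 1 ≤ xinv y := by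
  obtain ⟨c, hc, hc1⟩ := exists_between hlimsup
  refine ⟨c.toReal, ENNReal.toReal_nonneg,
    by simpa using ENNReal.toReal_strict_mono ENNReal.one_ne_top hc1, ?_⟩
  obtain ⟨X, hX⟩ := eventually_atTop.1 (eventually_lt_of_limsup_lt hc)
  set X₁ := max X (max x₀ 1) with hX₁
  have hXX : X ≤ X₁ := le_max_left _ _
  have hx₀X : x₀ ≤ X₁ := (le_max_left _ _).trans (le_max_right _ _)
  have h1X : 1 ≤ X₁ := (le_max_right _ _).trans (le_max_right _ _)
  filter_upwards [eventually_ge_atTop (X₁ + φ X₁)] with y hy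
  have hx₀y : x₀ + φ x₀ ≤ y := (hmono.monotoneOn (mem_Ici.2 le_rfl) hx₀X hx₀X).trans hy
  obtain ⟨h1, h2⟩ := hinv y hx₀y
  have h3 : X₁ ≤ xinv y := by
    rw [← hmono.le_iff_le hx₀X h1]
    simpa [h2] using hy
  have h4 : x₀ ≤ xinv y ^ 2 := by nlinarith [mem_Ici.1 h1]
  have h5 := hX (xinv y) (hXX.trans h3)
  rw [h2] at h5
  have h6 : g (y ^ 2) / g (xinv y ^ 2) ≤ c.toReal := by
    by_contra! h
    have := ENNReal.ofReal_le_ofReal h.le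
    rw [ENNReal.ofReal_toReal (ne_top_of_lt hc1)] at this
    exact absurd h5 (not_lt.2 this)
  rw [div_le_iff₀ (hg_pos _ h4)] at h6
  exact ⟨h6, h1, h1X.trans h3⟩

/-- Eventually, the derivative of `t ↦ (xinv √t) ^ 2` is bounded below by any `q < 1`. -/
lemma eventually_mul_le_mul_one_sub {C q : ℝ} (hC : 0 < C) (hq : q < 1) {xinv ψ' : ℝ → ℝ}
    (hx : ∀ᶠ y in atTop, y - C * Real.log y ≤ xinv y) (hψ' : ∀ᶠ y in atTop, y * ψ' y ≤ C) :
    ∀ᶠ y in atTop, q * y ≤ xinv y * (1 - ψ' y) := by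
  have hδ : 0 < (1 - q) / 2 := by linarith
  have h1 : ∀ᶠ y in atTop, C * (Real.log y / y) ≤ (1 - q) / 2 := by
    have h := Real.isLittleO_log_id_atTop.tendsto_div_nhds_zero.const_mul C
    rw [mul_zero] at h
    exact h.eventually_le_const hδ
  have h2 : ∀ᶠ y : ℝ in atTop, C * y⁻¹ ≤ (1 - q) / 2 := by
    have h := tendsto_inv_atTop_zero.const_mul C
    rw [mul_zero] at h
    exact h.eventually_le_const hδ
  have h3 : ∀ᶠ y : ℝ in atTop, C * y⁻¹ ≤ 1 := by
    have h := tendsto_inv_atTop_zero.const_mul C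
    rw [mul_zero] at h
    exact h.eventually_le_const one_pos
  have h4 : ∀ᶠ y : ℝ in atTop, C * (Real.log y / y) ≤ 1 := by
    have h := Real.isLittleO_log_id_atTop.tendsto_div_nhds_zero.const_mul C
    rw [mul_zero] at h
    exact h.eventually_le_const one_pos
  filter_upwards [hx, hψ', h1, h2, h3, h4, eventually_gt_atTop 0]
    with y hx hψ' h1 h2 h3 h4 hy
  have h5 : ψ' y ≤ C * y⁻¹ := by
    rw [← div_eq_mul_inv, le_div_iff₀ hy, mul_comm]
    exact hψ'
  have h6 : (1 - C * (Real.log y / y)) * y ≤ xinv y := by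
    refine le_trans (le_of_eq ?_) hx
    field_simp
  have h7 : 0 ≤ (1 - C * (Real.log y / y)) * y := mul_nonneg (by linarith) hy.le
  calc q * y ≤ (1 - C * (Real.log y / y)) * (1 - C * y⁻¹) * y := by
        gcongr
        have : 0 ≤ 1 - C * y⁻¹ := by linarith
        have hlog : C * (Real.log y / y) + C * y⁻¹ ≤ 1 - q := by linarith
        rcases le_or_gt 0 (C * (Real.log y / y)) with h | h
        · have : 0 ≤ C * y⁻¹ := by positivity
          nlinarith
        · nlinarith
    _ = (1 - C * (Real.log y / y)) * y * (1 - C * y⁻¹) := by ring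
    _ ≤ xinv y * (1 - ψ' y) := by
        gcongr
        linarith

/-- Theorem 2 (Stieltjes case): if `φ(x)/x → 0` and
`limsup_{x→∞} g((x+φ(x))²)/g(x²) < 1`, then `∑ ν_n^{-1/(2n)} = ∞` and
`G` is moment-determinate on `[0,∞)`. -/
theorem theorem2_stieltjes
    (x₀ : ℝ) (hx₀ : 0 < x₀)
    (φ : ℝ → ℝ)
    (hφ_nonneg : ∀ x ∈ Ici x₀, 0 ≤ φ x)
    (hφ_diff : DifferentiableOn ℝ φ (Ici x₀))
    (hmono : StrictMonoOn (fun x => x + φ x) (Ici x₀))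
    (xinv : ℝ → ℝ)
    (hinv₁ : ∀ x ∈ Ici x₀, xinv (x + φ x) = x)
    (hinv₂ : ∀ y ∈ Ici (x₀ + φ x₀), xinv y ∈ Ici x₀ ∧ xinv y + φ (xinv y) = y)
    (ψ ψ' : ℝ → ℝ)
    (hψ : ∀ y, ψ y = y - xinv y)
    (C ystar : ℝ) (hC : 0 < C) (hystar : x₀ + φ x₀ ≤ ystar)
    (hψ_deriv : ∀ y ∈ Ici ystar, HasDerivAt ψ (ψ' y) y)
    (hcond_a : ∀ y ∈ Ici ystar, ψ' y ∈ Icc (0 : ℝ) 1)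
    (hcond_b : ∀ y ∈ Ici ystar, ψ y ≤ C * Real.log y)
    (hcond_c : ∀ y ∈ Ici ystar, y * ψ' y ≤ C)
    (μ : Measure ℝ) [IsProbabilityMeasure μ]
    (hsupp : μ (Iio 0) = 0)
    (hmom : ∀ n : ℕ, Integrable (fun x => x ^ n) μ)
    (g : ℝ → ℝ) (hg_meas : Measurable g)
    (hg_ac : μ.restrict (Ici x₀) =
      (volume.restrict (Ici x₀)).withDensity (fun x => ENNReal.ofReal (g x)))
    (hg_pos : ∀ x ∈ Ici x₀, 0 < g x)
    (hφ_small : Tendsto (fun x => φ x / x) atTop (nhds 0))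
    (hlimsup : Filter.limsup
        (fun x => ENNReal.ofReal (g ((x + φ x) ^ 2) / g (x ^ 2))) atTop < 1) :
    Tendsto (fun N : ℕ => ∑ n ∈ Finset.Icc 1 N,
        (∫ x, x ^ n ∂μ) ^ (-(1 : ℝ) / (2 * n))) atTop atTop ∧
    IsMomentDetOnNonneg μ := by
  obtain ⟨ρ, hρ0, hρ1, hratio⟩ := exists_ratio_of_limsup_lt_one hmono hinv₂ hg_pos hlimsup
  obtain ⟨q, hq0, hq1, hρq⟩ : ∃ q : ℝ, 0 < q ∧ q < 1 ∧ ρ ≤ q ^ 3 :=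
    ⟨(3 + ρ) / 4, by linarith, by linarith, by
      nlinarith [mul_nonneg (sq_nonneg (ρ - 1)) (show 0 ≤ ρ + 11 by linarith)]⟩
  have hxψ : ∀ y, xinv y = y - ψ y := fun y => by rw [hψ]; ring
  have hxlog : ∀ y ∈ Ici ystar, y - C * Real.log y ≤ xinv y := fun y hy => by
    rw [hxψ]
    linarith [hcond_b y hy]
  have hxderiv : ∀ y ∈ Ici ystar, HasDerivAt xinv (1 - ψ' y) y := fun y hy => by
    rw [funext hxψ]
    exact (hasDerivAt_id y).sub (hψ_deriv y hy)
  have hslope := eventually_mul_le_mul_one_sub hC hq1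
    ((eventually_ge_atTop ystar).mono hxlog) ((eventually_ge_atTop ystar).mono hcond_c)
  obtain ⟨Y, hY⟩ := eventually_atTop.1 (hratio.and (hslope.and
    ((eventually_ge_atTop ystar).and (eventually_ge_atTop (Real.exp 1)))))
  have hxmono : ∀ y ∈ Ici ystar, ∀ z ∈ Ici ystar, y ≤ z → xinv y ≤ xinv z := by
    intro y hy z hz hyz
    obtain ⟨hy1, hy2⟩ := hinv₂ y (hystar.trans hy)
    obtain ⟨hz1, hz2⟩ := hinv₂ z (hystar.trans hz)
    rw [← hmono.le_iff_le hy1 hz1]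
    simpa [hy2, hz2] using hyz
  have hxinj : ∀ y ∈ Ici ystar, ∀ z ∈ Ici ystar, xinv y = xinv z → y = z := by
    intro y hy z hz hyz
    rw [← (hinv₂ y (hystar.trans hy)).2, hyz, (hinv₂ z (hystar.trans hz)).2]
  have htail : ∀ n : ℕ, 0 < n → ∀ T, max Y x₀ ≤ T →
      2 * n * C * Real.log T ≤ (1 - q) * T → ∫ x, x ^ n ∂μ ≤ (1 - q)⁻¹ * (T ^ 2) ^ n := by
    intro n hn T hYT hT
    have hYT' : Y ≤ T := (le_max_left _ _).trans hYT
    obtain ⟨⟨-, hxT, hxT1⟩, -, hTs, hTe⟩ := hY T hYT'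
    have hT1 : 1 ≤ T := by linarith [Real.add_one_le_exp 1]
    have hsqrt : ∀ t ∈ Ici (T ^ 2), T ≤ √t := fun t ht => Real.le_sqrt_of_sq_le ht
    have hmem : ∀ t ∈ Ici (T ^ 2), √t ∈ Ici ystar := fun t ht => hTs.trans (hsqrt t ht)
    have hTT : √(T ^ 2) = T := Real.sqrt_sq (by linarith)
    refine integral_pow_le_of_contraction (S := fun t => xinv √t ^ 2)
      (S' := fun t => 2 * xinv √t * ((1 - ψ' √t) * (1 / (2 * √t)))) hx₀ hg_meas hg_ac hsupp n
      (hmom n) ?_ hq0.le hq1 ?_ ?_ ?_ ?_ ?_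
    · nlinarith [le_max_right Y x₀]
    · intro t ht
      have h0 : t ≠ 0 := (lt_of_lt_of_le (by positivity) (mem_Ici.1 ht)).ne'
      have h : HasDerivAt (fun t => xinv √t) ((1 - ψ' √t) * (1 / (2 * √t))) t :=
        (hxderiv _ (hmem t ht)).comp t (Real.hasDerivAt_sqrt h0)
      simpa using h.fun_pow 2
    · intro s hs t ht hst
      have hs1 := (hY _ (hYT'.trans (hsqrt s hs))).1.2.2
      have ht1 := (hY _ (hYT'.trans (hsqrt t ht))).1.2.2
      have h1 := (sq_eq_sq₀ (by linarith) (by linarith)).1 hst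
      have h2 := hxinj _ (hmem s hs) _ (hmem t ht) h1
      have hT2 : 0 ≤ T ^ 2 := by positivity
      exact (Real.sqrt_inj (hT2.trans hs) (hT2.trans ht)).1 h2
    · simp only [hTT]
      nlinarith
    · intro t ht
      simp only [hTT]
      have := hxmono T hTs _ (hmem t ht) (hsqrt t ht)
      gcongr
    · intro t ht
      obtain ⟨⟨hg1, hx1, hx2⟩, hsl, -, -⟩ := hY _ (hYT'.trans (hsqrt t ht))
      have hyT := hsqrt t ht
      have ht0 : 0 ≤ t := (sq_nonneg T).trans ht
      have hpow := mul_pow_le_pow_of_log_le hC.le hq0.le n hn hTe hT hyT (hxlog _ (hmem t ht))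
      have hty : t = √t ^ 2 := (Real.sq_sqrt ht0).symm
      set y := √t with hy
      have hy0 : 0 < y := by linarith
      have hgx : 0 < g (xinv y ^ 2) := hg_pos _ (by simp only [mem_Ici]; nlinarith)
      have hS' : q ≤ |2 * xinv y * ((1 - ψ' y) * (1 / (2 * y)))| := by
        refine le_trans ?_ (le_abs_self _)
        rw [show 2 * xinv y * ((1 - ψ' y) * (1 / (2 * y))) = xinv y * (1 - ψ' y) / y by
          field_simp, le_div_iff₀ hy0]
        exact hsl
      calc t ^ n * g t = y ^ (2 * n) * g (y ^ 2) := by rw [pow_mul, ← hty]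
        _ ≤ y ^ (2 * n) * (q ^ 3 * g (xinv y ^ 2)) := by
            have := hg1.trans (mul_le_mul_of_nonneg_right hρq hgx.le)
            gcongr
        _ = q * (q * ((q * y ^ (2 * n)) * g (xinv y ^ 2))) := by ring
        _ ≤ q * (|2 * xinv y * ((1 - ψ' y) * (1 / (2 * y)))| *
              (xinv y ^ (2 * n) * g (xinv y ^ 2))) := by gcongr
        _ = _ := by rw [pow_mul]
  have hcar : Tendsto (fun N : ℕ => ∑ n ∈ Finset.Icc 1 N,
      (∫ x, x ^ n ∂μ) ^ (-(1 : ℝ) / (2 * n))) atTop atTop := by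
    have hδ : 0 < 1 - q := by linarith
    obtain ⟨K, hK0, hK⟩ := exists_const_forall_mul_log_le (D := 2 * C / (1 - q)) (by positivity)
      (max Y x₀)
    have hA : 1 ≤ (1 - q)⁻¹ := (one_le_inv₀ hδ).2 (by linarith)
    refine tendsto_sum_rpow_of_le
      (fun n _ => integral_pow_pos_of_density hx₀ hg_meas hg_ac hg_pos hsupp n (hmom n))
      (B := (1 - q)⁻¹ * K) (by positivity) fun n hn => ?_
    obtain ⟨h1, h2⟩ := hK n hn
    set T := K * (n * Real.log (n + 2)) with hT
    have h3 : 2 * n * C * Real.log T ≤ (1 - q) * T := by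
      calc 2 * n * C * Real.log T = (1 - q) * (n * (2 * C / (1 - q)) * Real.log T) := by
            field_simp
        _ ≤ (1 - q) * T := by gcongr
    have hT0 : 0 < T := hx₀.trans_le ((le_max_right _ _).trans h1)
    calc ∫ x, x ^ n ∂μ ≤ (1 - q)⁻¹ * (T ^ 2) ^ n := htail n hn T h1 h3
      _ ≤ (1 - q)⁻¹ ^ (2 * n) * (T ^ 2) ^ n := by
          gcongr
          exact le_self_pow₀ hA (by omega)
      _ = ((1 - q)⁻¹ * K * (n * Real.log (n + 2))) ^ (2 * n) := by
          rw [← pow_mul, ← mul_pow, hT, mul_assoc]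
  exact ⟨hcar, isMomentDetOnNonneg_of_carleman hsupp hmom hcar⟩
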